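/- arXiv:1208.2750 — 5 statements merged into one kernel-verified Lean document; each statement's English description precedes it below -/
import Mathlib

section
/- If a correct translation up to ∼ from 𝔏 into 𝔏' exists, then ∼ is a congruence for 𝔏. -/
/-- A translation `𝔗 : T → T'` between languages interpreted in domains
`Vv, Vv' ⊆ Z` is *correct up to* `sim` if condition (1) holds (every value in
`Vv` has a `sim`-related value in `Vv'`) and `⟦𝔗(E)⟧'(η) ∼ ⟦E⟧(ρ)` for all
expressions `E` and all `sim`-equivalent valuations `η : 𝓥 → Vv'`, `ρ : 𝓥 → Vv`. -/
def CorrectUpTo {Vars Z T T' : Type*} (Vv Vv' : Set Z)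
    (sem : T → (Vars → Vv) → Vv) (sem' : T' → (Vars → Vv') → Vv')
    (sim : Z → Z → Prop) (𝔗 : T → T') : Prop :=
  (∀ v : Vv, ∃ v' : Vv', sim (v' : Z) (v : Z)) ∧
  ∀ (E : T) (η : Vars → Vv') (ρ : Vars → Vv),
    (∀ X : Vars, sim ((η X : Z)) ((ρ X : Z))) →
      sim ((sem' (𝔗 E) η : Z)) ((sem E ρ : Z))

/-- The relation `sim` is a *congruence* for the language with expressions `T`
interpreted in the domain `Vv`: `⟦E⟧(ν) ∼ ⟦E⟧(ρ)` whenever `ν ∼ ρ`. -/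
def IsCongruence {Vars Z T : Type*} (Vv : Set Z)
    (sem : T → (Vars → Vv) → Vv) (sim : Z → Z → Prop) : Prop :=
  ∀ (E : T) (ν ρ : Vars → Vv),
    (∀ X : Vars, sim ((ν X : Z)) ((ρ X : Z))) →
      sim ((sem E ν : Z)) ((sem E ρ : Z))

/-- If a correct translation up to `∼` from `𝔏` into `𝔏'` exists,
then `∼` is a congruence for `𝔏`. -/
theorem stmt1 {Vars Z T T' : Type*} (Vv Vv' : Set Z)
    (sem : T → (Vars → Vv) → Vv) (sem' : T' → (Vars → Vv') → Vv')
    (sim : Z → Z → Prop) (hsim : Equivalence sim)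
    (h : ∃ 𝔗 : T → T', CorrectUpTo Vv Vv' sem sem' sim 𝔗) :
    IsCongruence Vv sem sim := by
  obtain ⟨𝔗, total, correct⟩ := h
  intro E ν ρ hνρ
  choose f hf using total
  have hν := correct E (fun X => f (ν X)) ν fun X => hf (ν X)
  have hρ := correct E (fun X => f (ν X)) ρ fun X => hsim.trans (hf (ν X)) (hνρ X)
  exact hsim.trans (hsim.symm hν) hρ
end

section
/- Let 𝔗 : T_𝔏 → T_𝔏' be a translation from 𝔏 into 𝔏', and let ∼ and ≈ be equivalence relations on 𝐙 that are both congruences for 𝔗(𝔏) (each with respect to its own relation), with ∼ finer than ≈. If 𝔗 is correct up to ∼, then 𝔗 is also correct up to ≈. -/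
/-- `𝐔ᴿ := {v' ∈ 𝐕' | ∃ v ∈ 𝐕, v' R v}`. -/
def USet {Z : Type*} (Vv Vv' : Set Z) (sim : Z → Z → Prop) : Set Z :=
  {v' | v' ∈ Vv' ∧ ∃ v ∈ Vv, sim v' v}

/-- The relation `R` is a *congruence for `𝔗(𝔏)`*:
`⟦𝔗(E)⟧'(ν) R ⟦𝔗(E)⟧'(η)` for every `E ∈ T_𝔏` and all `R`-equivalent
valuations `ν, η` into `𝐔ᴿ`. -/
def CongruenceForImage {Vars Z T T' : Type*} (Vv Vv' : Set Z)
    (sem' : T' → (Vars → Vv') → Vv') (sim : Z → Z → Prop) (𝔗 : T → T') : Prop :=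
  ∀ (E : T) (ν η : Vars → Vv'),
    (∀ X : Vars, (ν X : Z) ∈ USet Vv Vv' sim) →
    (∀ X : Vars, (η X : Z) ∈ USet Vv Vv' sim) →
    (∀ X : Vars, sim ((ν X : Z)) ((η X : Z))) →
      sim ((sem' (𝔗 E) ν : Z)) ((sem' (𝔗 E) η : Z))

/-- Let `𝔗` be a translation from `𝔏` into `𝔏'`, and let `∼` and
`≈` be equivalence relations on `Z`, both congruences for `𝔗(𝔏)` (each w.r.t.
its own relation), with `∼` finer than `≈`. If `𝔗` is correct up to `∼`, then
it is also correct up to `≈`. -/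
theorem stmt3 {Vars Z T T' : Type*} (Vv Vv' : Set Z)
    (sem : T → (Vars → Vv) → Vv) (sem' : T' → (Vars → Vv') → Vv')
    (sim approx : Z → Z → Prop)
    (hsim : Equivalence sim) (happrox : Equivalence approx)
    (𝔗 : T → T')
    (hcongSim : CongruenceForImage Vv Vv' sem' sim 𝔗)
    (hcongApprox : CongruenceForImage Vv Vv' sem' approx 𝔗)
    (hfiner : ∀ p q : Z, sim p q → approx p q)
    (hcorrect : CorrectUpTo Vv Vv' sem sem' sim 𝔗) :
    CorrectUpTo Vv Vv' sem sem' approx 𝔗 := by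
  obtain ⟨hrep, hsem⟩ := hcorrect
  choose f hf using hrep
  refine ⟨fun v => ⟨f v, hfiner _ _ (hf v)⟩, fun E η ρ hηρ => ?_⟩
  have hfρ : ∀ X, approx (f (ρ X) : Z) (ρ X : Z) := fun X => hfiner _ _ (hf (ρ X))
  have hcong : approx (sem' (𝔗 E) η : Z) (sem' (𝔗 E) (fun X => f (ρ X)) : Z) :=
    hcongApprox E η (fun X => f (ρ X))
      (fun X => ⟨(η X).2, ρ X, (ρ X).2, hηρ X⟩)
      (fun X => ⟨(f (ρ X)).2, ρ X, (ρ X).2, hfρ X⟩)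
      (fun X => happrox.trans (hηρ X) (happrox.symm (hfρ X)))
  exact happrox.trans hcong (hfiner _ _ (hsem E _ ρ fun X => hf (ρ X)))
end

section
/- If there is a correct translation up to ∼ from 𝔏 into 𝔏', and ≈ is a congruence for 𝔏' that is coarser than ∼ (i.e., ∼ is finer than ≈), then ≈ is a congruence for 𝔏. -/
/-- If there is a correct translation up to `∼` from `𝔏` into
`𝔏'`, and `≈` is a congruence for `𝔏'` that is coarser than `∼` (i.e. `∼` is
finer than `≈`), then `≈` is a congruence for `𝔏`. -/
theorem stmt4 {Vars Z T T' : Type*} (Vv Vv' : Set Z)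
    (sem : T → (Vars → Vv) → Vv) (sem' : T' → (Vars → Vv') → Vv')
    (sim approx : Z → Z → Prop)
    (hsim : Equivalence sim) (happrox : Equivalence approx)
    (h : ∃ 𝔗 : T → T', CorrectUpTo Vv Vv' sem sem' sim 𝔗)
    (hcong' : IsCongruence Vv' sem' approx)
    (hfiner : ∀ p q : Z, sim p q → approx p q) :
    IsCongruence Vv sem approx := by
  obtain ⟨𝔗, hdom, hcorr⟩ := h
  choose f hf using hdom
  have transfer (E : T) (ρ : Vars → Vv) :
      approx (sem' (𝔗 E) fun X => f (ρ X)) (sem E ρ) :=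
    hfiner _ _ (hcorr E _ ρ fun X => hf (ρ X))
  intro E ν ρ hνρ
  have hf_approx (X : Vars) : approx (f (ν X)) (f (ρ X)) :=
    happrox.trans (hfiner _ _ (hf (ν X)))
      (happrox.trans (hνρ X) (happrox.symm (hfiner _ _ (hf (ρ X)))))
  exact happrox.trans (happrox.symm (transfer E ν))
    (happrox.trans (hcong' (𝔗 E) _ _ hf_approx) (transfer E ρ))
end

section
/- Let 𝔗₀ be a correct translation up to ∼ from 𝔏 into 𝔏'. Suppose there is a well-founded relation ≺ on T_𝔏 and, for each expression E ∈ T_𝔏 that is not a variable, a head H_E ∈ T_𝔏 and a substitution σ_E : 𝓥 → T_𝔏 such that ⟦E⟧_𝔏 = ⟦H_E[σ_E]⟧_𝔏 and, for every X ∈ 𝓥, either σ_E(X) = X or σ_E(X) ≺ E. Then any translation 𝔗 : T_𝔏 → T_𝔏' satisfying 𝔗(X) = X for every variable X ∈ 𝓥 and ⟦𝔗(E)⟧_𝔏' = ⟦𝔗₀(H_E)[𝔗 ∘ σ_E]⟧_𝔏' for every non-variable E ∈ T_𝔏 is correct up to ∼. -/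
/-- Let `𝔗₀` be a correct translation up to `∼` from `𝔏` into
`𝔏'`. Suppose there is a well-founded relation `≺` on `T_𝔏` and, for each
non-variable expression `E`, a head `H_E` and a substitution `σ_E` with
`⟦E⟧ = ⟦H_E[σ_E]⟧` and, for every `X`, either `σ_E(X) = X` or `σ_E(X) ≺ E`.
Then any translation `𝔗` with `𝔗(X) = X` for variables and
`⟦𝔗(E)⟧' = ⟦𝔗₀(H_E)[𝔗 ∘ σ_E]⟧'` for non-variable `E` is correct up to `∼`.
Both languages contain the variables (`var`, `var'`), with `⟦X⟧(ρ) = ρ(X)`,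
and carry substitution operations satisfying the semantic substitution law
`⟦E[σ]⟧(ρ) = ⟦E⟧(λX. ⟦σ(X)⟧(ρ))`. -/
theorem stmt9 {Vars Z T T' : Type*} (Vv Vv' : Set Z)
    (sem : T → (Vars → Vv) → Vv) (sem' : T' → (Vars → Vv') → Vv')
    (sim : Z → Z → Prop) (hsim : Equivalence sim)
    (var : Vars → T) (var' : Vars → T')
    (subst : T → (Vars → T) → T) (subst' : T' → (Vars → T') → T')
    (hvar : ∀ (X : Vars) (ρ : Vars → Vv), sem (var X) ρ = ρ X)
    (hvar' : ∀ (X : Vars) (η : Vars → Vv'), sem' (var' X) η = η X)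
    (hsubst : ∀ (E : T) (σ : Vars → T) (ρ : Vars → Vv),
      sem (subst E σ) ρ = sem E (fun X => sem (σ X) ρ))
    (hsubst' : ∀ (E : T') (σ : Vars → T') (η : Vars → Vv'),
      sem' (subst' E σ) η = sem' E (fun X => sem' (σ X) η))
    (prec : T → T → Prop) (hwf : WellFounded prec)
    (headF : T → T) (substF : T → Vars → T)
    (hhead : ∀ E : T, E ∉ Set.range var →
      sem E = sem (subst (headF E) (substF E)) ∧
      ∀ X : Vars, substF E X = var X ∨ prec (substF E X) E)
    (𝔗₀ : T → T') (h𝔗₀ : CorrectUpTo Vv Vv' sem sem' sim 𝔗₀)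
    (𝔗 : T → T')
    (h𝔗var : ∀ X : Vars, 𝔗 (var X) = var' X)
    (h𝔗head : ∀ E : T, E ∉ Set.range var →
      sem' (𝔗 E) = sem' (subst' (𝔗₀ (headF E)) (fun X => 𝔗 (substF E X)))) :
    CorrectUpTo Vv Vv' sem sem' sim 𝔗 := by
  have correct_var : ∀ (X : Vars) (η : Vars → Vv') (ρ : Vars → Vv),
      (∀ Y : Vars, sim (η Y : Z) (ρ Y : Z)) →
        sim (sem' (𝔗 (var X)) η : Z) (sem (var X) ρ : Z) := by
    intro X η ρ hηρ
    rw [h𝔗var, hvar', hvar]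
    exact hηρ X
  refine ⟨h𝔗₀.1, fun E => ?_⟩
  induction E using hwf.induction with
  | _ E ih =>
    intro η ρ hηρ
    by_cases hE : E ∈ Set.range var
    · obtain ⟨X, rfl⟩ := hE
      exact correct_var X η ρ hηρ
    · obtain ⟨hsem, hσ⟩ := hhead E hE
      rw [h𝔗head E hE, hsem, hsubst, hsubst']
      refine h𝔗₀.2 _ _ _ fun X => ?_
      rcases hσ X with hX | hX
      · simpa only [hX] using correct_var X η ρ hηρ
      · exact ih _ hX η ρ hηρ
end

section
/- Let 𝔗 : T_𝔏 → T_𝔏' be a translation from 𝔏 into 𝔏', and let ∼ be a congruence for 𝔗(𝔏). If 𝔗 is compositional, respects ∼, and 𝔏 satisfies denotability, then 𝔗 is correct up to ∼. -/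
/-- The translation `𝔗` *respects* `sim`: condition (1) holds and for every
closed expression `P` (one whose meaning is the fixed value `v` independently
of the valuation) and every valuation `η` into `𝐔`, `⟦𝔗(P)⟧'(η) ∼ ⟦P⟧`. -/
def Respects {Vars Z T T' : Type*} (Vv Vv' : Set Z)
    (sem : T → (Vars → Vv) → Vv) (sem' : T' → (Vars → Vv') → Vv')
    (sim : Z → Z → Prop) (𝔗 : T → T') : Prop :=
  (∀ v : Vv, ∃ v' : Vv', sim (v' : Z) (v : Z)) ∧
  ∀ (P : T) (v : Vv), (∀ ρ : Vars → Vv, sem P ρ = v) →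
    ∀ η : Vars → Vv', (∀ X : Vars, (η X : Z) ∈ USet Vv Vv' sim) →
      sim ((sem' (𝔗 P) η : Z)) ((v : Z))

/-- Let `𝔗` be a translation from `𝔏` into `𝔏'` and `∼` a
congruence for `𝔗(𝔏)`. If `𝔗` is compositional, respects `∼`, and `𝔏`
satisfies denotability (every value of `𝐕` is the meaning of a closed term),
then `𝔗` is correct up to `∼`. Both languages carry substitution operations
satisfying the semantic substitution law. -/
theorem stmt10 {Vars Z T T' : Type*} (Vv Vv' : Set Z)
    (sem : T → (Vars → Vv) → Vv) (sem' : T' → (Vars → Vv') → Vv')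
    (sim : Z → Z → Prop) (hsim : Equivalence sim)
    (subst : T → (Vars → T) → T) (subst' : T' → (Vars → T') → T')
    (hsubst : ∀ (E : T) (σ : Vars → T) (ρ : Vars → Vv),
      sem (subst E σ) ρ = sem E (fun X => sem (σ X) ρ))
    (hsubst' : ∀ (E : T') (σ : Vars → T') (η : Vars → Vv'),
      sem' (subst' E σ) η = sem' E (fun X => sem' (σ X) η))
    (𝔗 : T → T')
    (hcong : CongruenceForImage Vv Vv' sem' sim 𝔗)
    (hcomp : ∀ (E : T) (σ : Vars → T),
      sem' (𝔗 (subst E σ)) = sem' (subst' (𝔗 E) (fun X => 𝔗 (σ X))))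
    (hresp : Respects Vv Vv' sem sem' sim 𝔗)
    (hden : ∀ v : Vv, ∃ P : T, ∀ ρ : Vars → Vv, sem P ρ = v) :
    CorrectUpTo Vv Vv' sem sem' sim 𝔗 := by
  refine ⟨hresp.1, fun E η ρ hηρ => ?_⟩
  choose P hP using hden
  have hη : ∀ X, (η X : Z) ∈ USet Vv Vv' sim := fun X =>
    ⟨(η X).2, ρ X, (ρ X).2, hηρ X⟩
  have hclosed : ∀ ρ', sem (subst E fun X => P (ρ X)) ρ' = sem E ρ := fun ρ' => by
    simp only [hsubst, hP]
  have hval : ∀ X, sim (sem' (𝔗 (P (ρ X))) η : Z) (ρ X : Z) := fun X =>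
    hresp.2 _ _ (hP (ρ X)) η hη
  have hsub := hresp.2 _ _ hclosed η hη
  rw [hcomp, hsubst'] at hsub
  refine hsim.trans (hcong E η _ hη (fun X => ?_) fun X => ?_) hsub
  · exact ⟨Subtype.coe_prop _, ρ X, (ρ X).2, hval X⟩
  · exact hsim.trans (hηρ X) (hsim.symm (hval X))
end
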